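/- Let M := { (z,w) ∈ ℂ² : |z| = |w| } ∖ {(0,0)}. A totally real C²-smooth disc K contained in M is polynomially convex if and only if K̂ ∩ { (z,w) ∈ ℂ² : zw = 0 } = ∅. -/

import Mathlib

noncomputable section

/-- The polynomial (convex) hull of a set `K ⊆ ℂⁿ`:
`K̂ = { z : |p(z)| ≤ sup_K |p| for every holomorphic polynomial p }`. -/
def polyHull (n : ℕ) (K : Set (Fin n → ℂ)) : Set (Fin n → ℂ) :=
  {z | ∀ p : MvPolynomial (Fin n) ℂ,
    ‖MvPolynomial.eval z p‖ ≤ sSup ((fun w => ‖MvPolynomial.eval w p‖) '' K)}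

/-- A set `K ⊆ ℂⁿ` is polynomially convex if it equals its polynomial hull. -/
def PolyConvex (n : ℕ) (K : Set (Fin n → ℂ)) : Prop := polyHull n K = K

/-- A Runge domain in `ℂⁿ`: a domain on which every holomorphic function can be
approximated uniformly on compact subsets by holomorphic polynomials. -/
def RungeDomain (n : ℕ) (Ω : Set (Fin n → ℂ)) : Prop :=
  IsOpen Ω ∧ IsConnected Ω ∧
  ∀ f : (Fin n → ℂ) → ℂ, DifferentiableOn ℂ f Ω →
    ∀ K : Set (Fin n → ℂ), K ⊆ Ω → IsCompact K → ∀ ε : ℝ, 0 < ε →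
      ∃ p : MvPolynomial (Fin n) ℂ, ∀ z ∈ K, ‖f z - MvPolynomial.eval z p‖ ≤ ε

/-- `K ⊆ ℂⁿ` is a totally real `C²`-smooth disc: the image of the closed unit
disc in `ℝ²` under a `C²` embedding `φ` (defined on an open neighborhood `U` of
the closed disc) whose image is a totally real submanifold, i.e. at each point
the tangent plane `W = range (dφ)` satisfies `W ∩ i·W = {0}`. -/
def TotallyRealDisc (n : ℕ) (K : Set (Fin n → ℂ)) : Prop :=
  ∃ (U : Set (ℝ × ℝ)) (φ : ℝ × ℝ → (Fin n → ℂ)),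
    IsOpen U ∧ Metric.closedBall (0 : ℝ × ℝ) 1 ⊆ U ∧
    ContDiffOn ℝ 2 φ U ∧ Set.InjOn φ U ∧
    (∀ x ∈ U, Function.Injective (fderiv ℝ φ x)) ∧
    (∀ x ∈ U, ∀ v w : ℝ × ℝ,
      fderiv ℝ φ x v = Complex.I • fderiv ℝ φ x w → fderiv ℝ φ x v = 0) ∧
    K = φ '' Metric.closedBall (0 : ℝ × ℝ) 1

theorem exists_continuous_log {E : Type*} [TopologicalSpace E] [AddCommGroup E] [Module ℝ E]
    [IsTopologicalAddGroup E] [ContinuousSMul ℝ E] [LocallyPathConnectedSpace E]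
    (F : E → ℂ) (hF : Continuous F) (h0 : ∀ x, F x ≠ 0) :
    ∃ l : E → ℂ, Continuous l ∧ ∀ x, Complex.exp (l x) = F x := by
  have : ContractibleSpace E := RealTopologicalVectorSpace.contractibleSpace
  obtain ⟨L, ⟨-, hL⟩, -⟩ := Complex.isCoveringMap_exp.existsUnique_continuousMap_lifts
    (A := E) ⟨fun x => ⟨F x, h0 x⟩, by fun_prop⟩ 0 (Complex.log (F 0))
    (by simp [Complex.exp_log (h0 0)])
  exact ⟨L, L.continuous, fun x => congrArg Subtype.val (congrFun hL x)⟩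

theorem not_exists_nonvanishing_eq_id_of_large (G : ℂ → ℂ) (hG : Continuous G)
    (h0 : ∀ z, G z ≠ 0) (R : ℝ) (hR : 0 < R) (hR' : ∀ z, ‖z‖ = R → G z = z) : False := by
  obtain ⟨l, hl, hlG⟩ := exists_continuous_log G hG h0
  have hz (s : ℝ) : ‖(R : ℂ) * Complex.exp (s * Complex.I)‖ = R := by
    simp [Complex.norm_exp_ofReal_mul_I, abs_of_pos hR]
  let m : ℝ → ℂ := fun s => l (R * Complex.exp (s * Complex.I)) - s * Complex.I
  have hm : Continuous m := by fun_prop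
  have hexp (s : ℝ) : Complex.exp (m s) = R := by
    simp only [m]
    rw [Complex.exp_sub, hlG, hR' _ (hz s)]
    field_simp [Complex.exp_ne_zero]
  have key : ∀ s : ℝ, m s = m 0 := by
    have h := Complex.isCoveringMap_exp.isSeparatedMap.eq_of_comp_eq
      Complex.isCoveringMap_exp.isLocalHomeomorph.isLocallyInjective hm
      (continuous_const (y := m 0)) (by ext s; simp [hexp]) (0 : ℝ) rfl
    exact fun s => congrFun h s
  have h2 := key (2 * Real.pi)
  have : (2 * Real.pi : ℂ) * Complex.I = 0 := by
    simp [m, Complex.exp_two_pi_mul_I] at h2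
  simp at this

/-- The polynomial hull of a planar set. -/
def planarHull (X : Set ℂ) : Set ℂ :=
  {a | ∀ (p : Polynomial ℂ) (C : ℝ), (∀ z ∈ X, ‖p.eval z‖ ≤ C) → ‖p.eval a‖ ≤ C}

theorem isClosed_planarHull (X : Set ℂ) : IsClosed (planarHull X) := by
  simp only [planarHull, Set.ofPred_forall]
  refine isClosed_iInter fun p => isClosed_iInter fun C => isClosed_iInter fun _ => ?_
  exact isClosed_le (p.continuous.norm) continuous_const

theorem exists_peak_of_notMem_planarHull {X : Set ℂ} {b : ℂ} (hb : b ∉ planarHull X)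
    {ε : ℝ} (hε : 0 < ε) :
    ∃ p : Polynomial ℂ, p.eval b = 1 ∧ ∀ z ∈ X, ‖p.eval z‖ ≤ ε := by
  simp only [planarHull, Set.mem_ofPred_eq, not_forall, not_le] at hb
  obtain ⟨p, C, hp, hC⟩ := hb
  rcases X.eq_empty_or_nonempty with rfl | ⟨x, hx⟩
  · exact ⟨1, by simp⟩
  have hC0 : 0 ≤ C := (norm_nonneg _).trans (hp x hx)
  have hpb : 0 < ‖p.eval b‖ := hC0.trans_lt hC
  have hlt : C / ‖p.eval b‖ < 1 := (div_lt_one hpb).2 hC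
  obtain ⟨n, hn⟩ := exists_pow_lt_of_lt_one hε hlt
  refine ⟨(Polynomial.C (p.eval b)⁻¹ * p) ^ n, ?_, fun z hz => ?_⟩
  · simp [inv_mul_cancel₀ (norm_pos_iff.1 hpb)]
  · simp only [Polynomial.eval_pow, Polynomial.eval_mul, Polynomial.eval_C, norm_pow, norm_mul,
      norm_inv]
    refine le_trans ?_ hn.le
    gcongr
    rw [inv_mul_eq_div]
    gcongr
    exact hp z hz

theorem isOpen_planarHull_diff {X : Set ℂ} (hX : IsCompact X) : IsOpen (planarHull X \ X) := by
  rw [Metric.isOpen_iff]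
  rintro b ⟨hb, hbX⟩
  obtain ⟨d, hd, hdX⟩ := Metric.isOpen_iff.1 hX.isClosed.isOpen_compl b hbX
  have hdist : ∀ z ∈ X, d ≤ ‖z - b‖ := fun z hz => by
    by_contra! h
    exact hdX (by simpa [dist_eq_norm] using h) hz
  obtain ⟨B, hB⟩ := hX.isBounded.exists_norm_le
  have hB0 : 0 ≤ |B| + ‖b‖ + 1 := by positivity
  refine ⟨d / 8, by positivity, fun c hc => ?_⟩
  rw [Metric.mem_ball, dist_eq_norm] at hc
  refine ⟨?_, fun h => by have := hdist c h; linarith⟩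
  by_contra hcH
  set A := |B| + ‖b‖ + 1 with hA
  obtain ⟨p, hp1, hp⟩ := exists_peak_of_notMem_planarHull hcH (ε := d / 8 / A) (by positivity)
  obtain ⟨q, hq⟩ := Polynomial.dvd_iff_isRoot.2 (show (1 - p).IsRoot c by simp [hp1])
  have hq' (z : ℂ) : 1 - p.eval z = (z - c) * q.eval z := by
    simpa using congrArg (Polynomial.eval z) hq
  have := hb (1 - (Polynomial.X - Polynomial.C b) * q) (1 / 2) fun z hz => by
    have h1 := hdist z hz
    have h2 : d / 2 ≤ ‖z - c‖ := by
      have : ‖z - b‖ ≤ ‖z - c‖ + ‖c - b‖ := norm_sub_le_norm_sub_add_norm_sub z c b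
      linarith
    have h3 : ‖z - b‖ ≤ A := by
      have := norm_sub_le z b
      have := hB z hz
      have := le_abs_self B
      linarith
    have h4 : (z - c) * (1 - (z - b) * q.eval z) = (b - c) + (z - b) * p.eval z := by
      have := hq' z
      linear_combination (z - b) * this
    have h5 : ‖z - c‖ * ‖1 - (z - b) * q.eval z‖ ≤ d / 8 + A * (d / 8 / A) := by
      rw [← norm_mul, h4]
      refine (norm_add_le _ _).trans ?_
      rw [norm_mul, norm_sub_rev b c]
      gcongr
      exact hp z hz
    have h6 : A * (d / 8 / A) = d / 8 := mul_div_cancel₀ _ (by positivity)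
    simp only [Polynomial.eval_sub, Polynomial.eval_one, Polynomial.eval_mul, Polynomial.eval_X,
      Polynomial.eval_C]
    have := norm_nonneg (1 - (z - b) * q.eval z)
    nlinarith
  simp at this
  norm_num at this

/-- A point of the hull off the set: `z - a` has no continuous logarithm on the set. -/
theorem no_log_of_mem_planarHull {X : Set ℂ} (hX : IsCompact X) {a : ℂ} (ha : a ∈ planarHull X)
    (u : ℂ → ℂ) (hu : Continuous u) (hux : ∀ z ∈ X, Complex.exp (u z) = z - a) :
    False := by
  classical
  obtain ⟨B, hB⟩ := hX.isBounded.exists_norm_le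
  have hfr : ∀ z ∈ frontier (planarHull X), z ∈ X := by
    intro z hz
    by_contra hzX
    have hzH := (isClosed_planarHull X).frontier_subset hz
    exact hz.2 (interior_maximal Set.sdiff_subset (isOpen_planarHull_diff hX) ⟨hzH, hzX⟩)
  let G : ℂ → ℂ := fun z => if z ∈ planarHull X then Complex.exp (u z) else z - a
  have hG : Continuous G := Continuous.if (fun z hz => hux z (hfr z hz)) (by fun_prop) (by fun_prop)
  have hG0 : ∀ z, G z ≠ 0 := fun z => by
    simp only [G]
    split_ifs with h
    · exact Complex.exp_ne_zero _
    · rintro h'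
      exact h ((sub_eq_zero.1 h') ▸ ha)
  refine not_exists_nonvanishing_eq_id_of_large (fun z => G (z + a)) (by fun_prop)
    (fun z => hG0 _) (|B| + ‖a‖ + 1) (by positivity) fun z hz => ?_
  have : z + a ∉ planarHull X := fun h => by
    have h1 := h Polynomial.X B (by simpa using hB)
    simp only [Polynomial.eval_X] at h1
    have h2 : ‖z‖ ≤ ‖z + a‖ + ‖a‖ := by simpa using norm_sub_le (z + a) a
    have := le_abs_self B
    linarith
  simp [G, this]

/-- `Y ⊆ ℝ × ℂ` is tangent at each of its points to a plane transverse to `{0} × ℂ`, namely the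
real span of `(1, α)` and `(0, b)`. -/
def HasTransversePlanes (Y : Set (ℝ × ℂ)) : Prop :=
  ∀ p ∈ Y, ∃ α b : ℂ, b ≠ 0 ∧ ∀ ε > 0, ∃ δ > 0, ∀ y ∈ Y, ∀ y' ∈ Y, dist y p < δ → dist y' p < δ →
    |((y.2 - y'.2 - (y.1 - y'.1) * α) / b).im| ≤ ε * ‖y - y'‖

theorem HasTransversePlanes.exists_local_segment {Y : Set (ℝ × ℂ)} (hY : HasTransversePlanes Y)
    {p : ℝ × ℂ} (hp : p ∈ Y) : ∃ δ > 0, ∀ r ∉ Y, dist r p < δ →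
      ∃ d : ℂ, ∀ τ ∈ Set.Icc (0 : ℝ) δ, (r.1 + τ, r.2 + τ * d) ∉ Y := by
  obtain ⟨α, b, hb, H⟩ := hY p hp
  set A := 1 + ‖α‖ + ‖b‖ with hA
  have hA1 : 1 ≤ A := by have := norm_nonneg α; have := norm_nonneg b; linarith
  obtain ⟨δ, hδ, H⟩ := H (1 / (2 * A)) (by positivity)
  refine ⟨δ / (4 * A), by positivity, fun r hr hrp => ?_⟩
  by_contra! hcon
  obtain ⟨τ, hτ, hy⟩ := hcon (α + Complex.I * b)
  obtain ⟨τ', hτ', hy'⟩ := hcon (α - Complex.I * b)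
  have hδA : δ / (4 * A) * A = δ / 4 := by field_simp
  have hδ4 : δ / (4 * A) ≤ δ / 4 := by
    have : 0 < δ / (4 * A) := by positivity
    nlinarith
  have near : ∀ τ ∈ Set.Icc (0 : ℝ) (δ / (4 * A)), ∀ d : ℂ, ‖d‖ ≤ A →
      dist (r.1 + τ, r.2 + τ * d) p < δ := by
    intro τ hτ d hd
    refine (dist_triangle _ r _).trans_lt ?_
    have : dist (r.1 + τ, r.2 + τ * d) r ≤ δ / 4 := by
      rw [Prod.dist_eq]
      simp only [dist_eq_norm, add_sub_cancel_left, norm_mul, Complex.norm_real, Real.norm_eq_abs,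
        abs_of_nonneg hτ.1]
      refine max_le (hτ.2.trans hδ4) ?_
      rw [← hδA]
      exact mul_le_mul hτ.2 hd (norm_nonneg _) (by positivity)
    linarith
  have n1 : ‖α + Complex.I * b‖ ≤ A := by
    have := norm_add_le α (Complex.I * b)
    simp at this
    linarith
  have n2 : ‖α - Complex.I * b‖ ≤ A := by
    have := norm_sub_le α (Complex.I * b)
    simp at this
    linarith
  have h1 := H _ hy _ hy' (near τ hτ _ n1) (near τ' hτ' _ n2)
  have h2 : ((r.2 + τ * (α + Complex.I * b) - (r.2 + τ' * (α - Complex.I * b)) -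
      (((r.1 + τ : ℝ) : ℂ) - ((r.1 + τ' : ℝ) : ℂ)) * α) / b) = ((τ + τ' : ℝ) : ℂ) * Complex.I := by
    field_simp
    push_cast
    ring
  have h3 : ‖((r.1 + τ, r.2 + τ * (α + Complex.I * b)) : ℝ × ℂ) -
      (r.1 + τ', r.2 + τ' * (α - Complex.I * b))‖ ≤ (τ + τ') * A := by
    rw [Prod.mk_sub_mk, Prod.norm_mk]
    have h0 := hτ.1
    have h0' := hτ'.1
    refine max_le ?_ ?_
    · rw [add_sub_add_left_eq_sub, Real.norm_eq_abs]
      have : |τ - τ'| ≤ τ + τ' := abs_sub_le_iff.2 ⟨by linarith, by linarith⟩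
      nlinarith
    · rw [add_sub_add_left_eq_sub]
      refine (norm_sub_le _ _).trans ?_
      simp only [norm_mul, Complex.norm_real, Real.norm_eq_abs, abs_of_nonneg h0, abs_of_nonneg h0']
      rw [add_mul]
      gcongr
  dsimp only at h1
  rw [h2, Complex.im_ofReal_mul, Complex.I_im, mul_one,
    abs_of_nonneg (add_nonneg hτ.1 hτ'.1)] at h1
  have h4 : τ + τ' ≤ (τ + τ') / 2 := by
    refine h1.trans ((mul_le_mul_of_nonneg_left h3 (by positivity)).trans_eq ?_)
    field_simp
  have h5 : τ = 0 := by have := hτ.1; have := hτ'.1; linarith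
  subst h5
  simp at hy
  exact hr hy

theorem HasTransversePlanes.exists_uniform_segment {Y : Set (ℝ × ℂ)} (hc : IsCompact Y)
    (hY : HasTransversePlanes Y) : ∃ δ > 0, ∀ r ∉ Y,
      ∃ d : ℂ, ∀ τ ∈ Set.Icc (0 : ℝ) δ, (r.1 + τ, r.2 + τ * d) ∉ Y := by
  have key : ∃ δ > 0, ∀ r ∉ Y, (∃ y ∈ Y, dist r y < δ) →
      ∃ d : ℂ, ∀ τ ∈ Set.Icc (0 : ℝ) δ, (r.1 + τ, r.2 + τ * d) ∉ Y := by
    refine hc.induction_on (p := fun s => ∃ δ > 0, ∀ r ∉ Y, (∃ y ∈ s, dist r y < δ) →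
      ∃ d : ℂ, ∀ τ ∈ Set.Icc (0 : ℝ) δ, (r.1 + τ, r.2 + τ * d) ∉ Y) ?_ ?_ ?_ ?_
    · exact ⟨1, one_pos, fun r _ ⟨y, hy, _⟩ => hy.elim⟩
    · rintro s t hst ⟨δ, hδ, h⟩
      exact ⟨δ, hδ, fun r hr ⟨y, hy, hry⟩ => h r hr ⟨y, hst hy, hry⟩⟩
    · rintro s t ⟨δ, hδ, h⟩ ⟨δ', hδ', h'⟩
      refine ⟨min δ δ', lt_min hδ hδ', fun r hr ⟨y, hy, hry⟩ => ?_⟩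
      rcases hy with hy | hy
      · obtain ⟨d, hd⟩ := h r hr ⟨y, hy, hry.trans_le (min_le_left _ _)⟩
        exact ⟨d, fun τ hτ => hd τ ⟨hτ.1, hτ.2.trans (min_le_left _ _)⟩⟩
      · obtain ⟨d, hd⟩ := h' r hr ⟨y, hy, hry.trans_le (min_le_right _ _)⟩
        exact ⟨d, fun τ hτ => hd τ ⟨hτ.1, hτ.2.trans (min_le_right _ _)⟩⟩
    · intro p hp
      obtain ⟨δ, hδ, h⟩ := hY.exists_local_segment hp
      refine ⟨_, mem_nhdsWithin_of_mem_nhds (Metric.ball_mem_nhds p (half_pos hδ)), δ / 2,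
        half_pos hδ, fun r hr ⟨y, hy, hry⟩ => ?_⟩
      obtain ⟨d, hd⟩ := h r hr ((dist_triangle r y p).trans_lt (by
        have := Metric.mem_ball.1 hy
        linarith))
      exact ⟨d, fun τ hτ => hd τ ⟨hτ.1, hτ.2.trans (by linarith)⟩⟩
  obtain ⟨δ, hδ, h⟩ := key
  refine ⟨δ / 2, half_pos hδ, fun r hr => ?_⟩
  by_cases hn : ∃ y ∈ Y, dist r y < δ
  · obtain ⟨d, hd⟩ := h r hr hn
    exact ⟨d, fun τ hτ => hd τ ⟨hτ.1, hτ.2.trans (by linarith)⟩⟩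
  · refine ⟨0, fun τ hτ hmem => hn ⟨_, hmem, ?_⟩⟩
    have h0 := hτ.1
    have h1 := hτ.2
    rw [Prod.dist_eq]
    simp only [mul_zero, add_zero, dist_self, dist_self_add_right, Real.norm_eq_abs,
      abs_of_nonneg h0]
    exact max_lt (by linarith) hδ

theorem HasTransversePlanes.exists_path_above {Y : Set (ℝ × ℂ)} (hc : IsCompact Y)
    (hY : HasTransversePlanes Y) {t₀ : ℝ} {a₀ : ℂ} (h : (t₀, a₀) ∉ Y) :
    ∃ γ : ℝ → ℂ, Continuous γ ∧ γ t₀ = a₀ ∧ ∀ s ≥ t₀, (s, γ s) ∉ Y := by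
  obtain ⟨δ, hδ, H⟩ := hY.exists_uniform_segment hc
  have step (n : ℕ) : ∃ γ : ℝ → ℂ, Continuous γ ∧ γ t₀ = a₀ ∧
      ∀ s ∈ Set.Icc t₀ (t₀ + n * δ), (s, γ s) ∉ Y := by
    induction n with
    | zero =>
      refine ⟨fun _ => a₀, continuous_const, rfl, fun s hs => ?_⟩
      obtain rfl : s = t₀ := by simpa using hs
      exact h
    | succ n ih =>
      obtain ⟨γ, hγ, h0, hav⟩ := ih
      set t := t₀ + n * δ with ht
      have htt : t₀ ≤ t := by have : 0 ≤ n * δ := by positivity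
                              linarith
      obtain ⟨d, hd⟩ := H (t, γ t) (hav t ⟨htt, le_rfl⟩)
      refine ⟨fun s => γ (min s t) + (max (s - t) 0 : ℝ) * d, by fun_prop, ?_, fun s hs => ?_⟩
      · simp [min_eq_left htt, max_eq_right (sub_nonpos.2 htt), h0]
      · rcases le_total s t with hst | hst
        · simpa [min_eq_left hst, max_eq_right (sub_nonpos.2 hst)] using hav s ⟨hs.1, hst⟩
        · have h2 : s ≤ t + δ := by
            have := hs.2
            push_cast at this
            linarith
          have := hd (s - t) ⟨sub_nonneg.2 hst, by linarith⟩
          simpa [min_eq_right hst, max_eq_left (sub_nonneg.2 hst)] using this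
  obtain ⟨B, hB⟩ := hc.isBounded.exists_norm_le
  obtain ⟨n, hn⟩ := exists_nat_gt ((B - t₀) / δ)
  obtain ⟨γ, hγ, h0, hav⟩ := step n
  refine ⟨γ, hγ, h0, fun s hs hmem => ?_⟩
  rw [div_lt_iff₀ hδ] at hn
  rcases le_total s (t₀ + n * δ) with h1 | h1
  · exact hav s ⟨hs, h1⟩ hmem
  · have h2 := (norm_fst_le _).trans (hB _ hmem)
    have := le_abs_self s
    simp only [Real.norm_eq_abs] at h2
    linarith

theorem HasTransversePlanes.reflect {Y : Set (ℝ × ℂ)} (hY : HasTransversePlanes Y) :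
    HasTransversePlanes ((fun y : ℝ × ℂ => (-y.1, y.2)) ⁻¹' Y) := by
  intro p hp
  obtain ⟨α, b, hb, H⟩ := hY _ hp
  refine ⟨-α, b, hb, fun ε hε => ?_⟩
  obtain ⟨δ, hδ, H⟩ := H ε hε
  refine ⟨δ, hδ, fun y hy y' hy' hd hd' => ?_⟩
  have hdist (u v : ℝ × ℂ) : dist ((-u.1, u.2) : ℝ × ℂ) (-v.1, v.2) = dist u v := by
    simp [Prod.dist_eq]
  have := H _ hy _ hy' (by rwa [hdist]) (by rwa [hdist])
  rw [← dist_eq_norm] at this ⊢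
  rw [hdist] at this
  convert! this using 5
  push_cast
  ring

theorem HasTransversePlanes.exists_path {Y : Set (ℝ × ℂ)} (hc : IsCompact Y)
    (hY : HasTransversePlanes Y) {t₀ : ℝ} {a₀ : ℂ} (h : (t₀, a₀) ∉ Y) :
    ∃ γ : ℝ → ℂ, Continuous γ ∧ γ t₀ = a₀ ∧ ∀ s, (s, γ s) ∉ Y := by
  obtain ⟨γ, hγ, h0, hav⟩ := hY.exists_path_above hc h
  have hc' : IsCompact ((fun y : ℝ × ℂ => (-y.1, y.2)) ⁻¹' Y) :=
    ((Homeomorph.neg ℝ).prodCongr (Homeomorph.refl ℂ)).isCompact_preimage.2 hc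
  obtain ⟨γ', hγ', h0', hav'⟩ := hY.reflect.exists_path_above hc' (t₀ := -t₀) (a₀ := a₀)
    (by simpa using h)
  refine ⟨fun s => γ (max s t₀) + γ' (-min s t₀) - a₀, by fun_prop, by simp [h0, h0'],
    fun s => ?_⟩
  rcases le_total s t₀ with hs | hs
  · simpa [hs, h0] using hav' (-s) (neg_le_neg hs)
  · simpa [hs, h0'] using hav s hs

/-- The polynomial hull, written without suprema. -/
def polyHullBound (n : ℕ) (K : Set (Fin n → ℂ)) : Set (Fin n → ℂ) :=
  {z | ∀ (p : MvPolynomial (Fin n) ℂ) (C : ℝ),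
    (∀ w ∈ K, ‖MvPolynomial.eval w p‖ ≤ C) → ‖MvPolynomial.eval z p‖ ≤ C}

/-- Restriction of polynomials to `K`. -/
def polyRestrict (n : ℕ) (K : Set (Fin n → ℂ)) : MvPolynomial (Fin n) ℂ →ₐ[ℂ] C(K, ℂ) :=
  MvPolynomial.aeval fun i => ⟨fun x : K => x.1 i, (continuous_apply i).comp continuous_subtype_val⟩

theorem polyRestrict_apply {n : ℕ} {K : Set (Fin n → ℂ)} (p : MvPolynomial (Fin n) ℂ) (x : K) :
    polyRestrict n K p x = MvPolynomial.eval x.1 p := by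
  induction p using MvPolynomial.induction_on with
  | C a => simp [polyRestrict]
  | add p q hp hq => simp [hp, hq]
  | mul_X p i hp => rw [map_mul, ContinuousMap.mul_apply, hp]; simp [polyRestrict]

/-- The uniform closure of the polynomials on a compact set `K`. -/
def polyAlg (n : ℕ) (K : Set (Fin n → ℂ)) [CompactSpace K] : Subalgebra ℂ C(K, ℂ) :=
  (polyRestrict n K).range.topologicalClosure

theorem polyRestrict_mem_polyAlg {n : ℕ} {K : Set (Fin n → ℂ)} [CompactSpace K]
    (p : MvPolynomial (Fin n) ℂ) : polyRestrict n K p ∈ polyAlg n K :=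
  Subalgebra.le_topologicalClosure _ ⟨p, rfl⟩

theorem Subalgebra.exists_algHom_apply_eq_zero {B : Type*} [NormedCommRing B] [NormedAlgebra ℂ B]
    [CompleteSpace B] [NormOneClass B] (A : Subalgebra ℂ B) (hA : IsClosed (A : Set B)) {a : A}
    (ha : ¬IsUnit a) : ∃ ψ : A →ₐ[ℂ] ℂ, ψ a = 0 ∧ ∀ b : A, ‖ψ b‖ ≤ ‖(b : B)‖ := by
  have : CompleteSpace A := hA.completeSpace_coe
  have : NormOneClass A := ⟨norm_one (α := B)⟩
  obtain ⟨χ, hχ⟩ := WeakDual.CharacterSpace.exists_apply_eq_zero ha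
  exact ⟨WeakDual.CharacterSpace.toAlgHom χ, hχ, fun b =>
    AlgHom.norm_apply_le_self (WeakDual.CharacterSpace.toAlgHom χ) b⟩

theorem exists_inv_mem_polyAlg {n : ℕ} {K : Set (Fin n → ℂ)} [CompactSpace K] (hK : K.Nonempty)
    (i : Fin n) (hi : ∀ z ∈ polyHullBound n K, z i ≠ 0) :
    ∃ g ∈ polyAlg n K, ∀ x : K, x.1 i * g x = 1 := by
  have : Nonempty K := hK.to_subtype
  let A := polyAlg n K
  have hAc : IsClosed (A : Set C(K, ℂ)) := Subalgebra.isClosed_topologicalClosure _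
  let P (p : MvPolynomial (Fin n) ℂ) : A := ⟨polyRestrict n K p, polyRestrict_mem_polyAlg p⟩
  by_cases hu : IsUnit (P (MvPolynomial.X i))
  · obtain ⟨g, hg⟩ := hu.exists_right_inv
    refine ⟨g.1, g.2, fun x => ?_⟩
    have := congrArg (fun f : A => f.1 x) hg
    simpa [P, polyRestrict_apply] using this
  · obtain ⟨ψ, hψ, hnorm⟩ := A.exists_algHom_apply_eq_zero hAc hu
    let Q : MvPolynomial (Fin n) ℂ →ₐ[ℂ] A :=
      (polyRestrict n K).codRestrict A fun p => polyRestrict_mem_polyAlg p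
    let z : Fin n → ℂ := fun j => ψ (Q (MvPolynomial.X j))
    have hz (p : MvPolynomial (Fin n) ℂ) : ψ (Q p) = MvPolynomial.eval z p := by
      have : ψ.comp Q = MvPolynomial.aeval z := by
        ext j
        simp [z]
      exact (DFunLike.congr_fun this p).trans (by rw [MvPolynomial.aeval_eq_eval])
    refine absurd hψ (hi z fun p C hC => ?_)
    rw [← hz]
    refine (hnorm (Q p)).trans ?_
    change ‖polyRestrict n K p‖ ≤ C
    refine (ContinuousMap.norm_le_of_nonempty _).2 fun x => ?_
    rw [polyRestrict_apply]
    exact hC x x.2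

theorem norm_le_of_mem_polyAlg {n : ℕ} {K : Set (Fin n → ℂ)} {z : Fin n → ℂ}
    (hz : z ∈ polyHullBound n K) [CompactSpace ↥(insert z K)] {F : C(↥(insert z K), ℂ)}
    (hF : F ∈ polyAlg n (insert z K)) {C : ℝ}
    (hC : ∀ x (hx : x ∈ K), ‖F ⟨x, Set.mem_insert_of_mem _ hx⟩‖ ≤ C) :
    ‖F ⟨z, Set.mem_insert _ _⟩‖ ≤ C := by
  refine le_of_forall_pos_le_add fun ε hε => ?_
  obtain ⟨_, ⟨p, rfl⟩, hp⟩ := Metric.mem_closure_iff.1 hF (ε / 2) (half_pos hε)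
  have hd (x : ↥(insert z K)) : ‖F x - MvPolynomial.eval x.1 p‖ ≤ ε / 2 := by
    rw [← polyRestrict_apply, ← dist_eq_norm]
    exact (ContinuousMap.dist_apply_le_dist x).trans hp.le
  have h1 := hz p (C + ε / 2) fun w hw => by
    have := hd ⟨w, Set.mem_insert_of_mem _ hw⟩
    have h2 := norm_le_norm_add_norm_sub (F ⟨w, Set.mem_insert_of_mem _ hw⟩)
      (MvPolynomial.eval w p)
    have := hC w hw
    dsimp only at *
    linarith
  have h2 := hd ⟨z, Set.mem_insert _ _⟩
  have h3 := norm_le_norm_add_norm_sub' (F ⟨z, Set.mem_insert _ _⟩) (MvPolynomial.eval z p)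
  dsimp only at *
  linarith

/-- If `h` peaks exactly on `E`, points of the hull where `h = 1` are controlled by `E`. -/
theorem norm_le_of_peak {n : ℕ} {K : Set (Fin n → ℂ)} (hK : IsCompact K) {z : Fin n → ℂ}
    (hz : z ∈ polyHullBound n K) [CompactSpace ↥(insert z K)] {F h : C(↥(insert z K), ℂ)}
    (hF : F ∈ polyAlg n (insert z K)) (hh : h ∈ polyAlg n (insert z K))
    (hhz : h ⟨z, Set.mem_insert _ _⟩ = 1)
    (hh1 : ∀ x (hx : x ∈ K), ‖h ⟨x, Set.mem_insert_of_mem _ hx⟩‖ ≤ 1) {C : ℝ} (hC0 : 0 ≤ C)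
    (hC : ∀ x (hx : x ∈ K), ‖h ⟨x, Set.mem_insert_of_mem _ hx⟩‖ = 1 →
      ‖F ⟨x, Set.mem_insert_of_mem _ hx⟩‖ ≤ C) :
    ‖F ⟨z, Set.mem_insert _ _⟩‖ ≤ C := by
  refine le_of_forall_pos_le_add fun ε hε => ?_
  have : CompactSpace K := isCompact_iff_compactSpace.1 hK
  let ι : K → ↥(insert z K) := fun x => ⟨x.1, Set.mem_insert_of_mem _ x.2⟩
  have hι : Continuous ι := by fun_prop
  let S : Set K := {x | C + ε ≤ ‖F (ι x)‖}
  have hS : IsCompact S := (isClosed_le continuous_const (by fun_prop)).isCompact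
  obtain ⟨ρ, hρ0, hρ1, hρ⟩ : ∃ ρ : ℝ, 0 ≤ ρ ∧ ρ < 1 ∧ ∀ x ∈ S, ‖h (ι x)‖ ≤ ρ := by
    rcases S.eq_empty_or_nonempty with hS0 | hS0
    · exact ⟨0, le_rfl, one_pos, by simp [hS0]⟩
    · obtain ⟨x, hx, hmax⟩ := hS.exists_isMaxOn hS0 (f := fun x => ‖h (ι x)‖)
        (Continuous.continuousOn (by fun_prop))
      refine ⟨_, norm_nonneg _, lt_of_le_of_ne (hh1 x x.2) fun h1 => ?_, fun y hy => hmax hy⟩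
      have h2 := hC x x.2 h1
      have h3 : C + ε ≤ ‖F (ι x)‖ := hx
      have h4 : ‖F (ι x)‖ ≤ C := h2
      linarith
  obtain ⟨N, hN⟩ := exists_pow_lt_of_lt_one (show 0 < (C + ε) / (‖F‖ + 1) by positivity) hρ1
  have key := norm_le_of_mem_polyAlg hz (F := F * h ^ N) (mul_mem hF (pow_mem hh N))
    (C := C + ε) fun x hx => by
      have hmul : ‖(F * h ^ N) (ι ⟨x, hx⟩)‖ = ‖F (ι ⟨x, hx⟩)‖ * ‖h (ι ⟨x, hx⟩)‖ ^ N := by simp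
      change ‖(F * h ^ N) (ι ⟨x, hx⟩)‖ ≤ _
      rw [hmul]
      have hp1 : ‖h (ι ⟨x, hx⟩)‖ ^ N ≤ 1 := pow_le_one₀ (norm_nonneg _) (hh1 x hx)
      by_cases hxS : (⟨x, hx⟩ : K) ∈ S
      · calc ‖F (ι ⟨x, hx⟩)‖ * ‖h (ι ⟨x, hx⟩)‖ ^ N
            ≤ (‖F‖ + 1) * ρ ^ N := by
              gcongr
              · have := F.norm_coe_le_norm (ι ⟨x, hx⟩)
                linarith
              · exact hρ _ hxS
          _ ≤ (‖F‖ + 1) * ((C + ε) / (‖F‖ + 1)) := by gcongr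
          _ = C + ε := by field_simp
      · have h5 : ‖F (ι ⟨x, hx⟩)‖ < C + ε := not_le.1 hxS
        have := norm_nonneg (F (ι ⟨x, hx⟩))
        nlinarith
  simpa [hhz] using key

theorem eval_aeval_X {n : ℕ} (i : Fin n) (q : Polynomial ℂ) (y : Fin n → ℂ) :
    MvPolynomial.eval y (Polynomial.aeval (MvPolynomial.X i) q) = q.eval (y i) := by
  induction q using Polynomial.induction_on' with
  | add p q hp hq => simp [hp, hq]
  | monomial k a => simp [Polynomial.aeval_monomial, MvPolynomial.algebraMap_eq]

theorem mem_planarHull_fibre {K : Set (Fin 2 → ℂ)} (hK : IsCompact K)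
    (hKM : ∀ x ∈ K, ‖x 0‖ = ‖x 1‖) {z : Fin 2 → ℂ}
    (hz : z ∈ polyHullBound 2 K) (h0 : ∀ y ∈ polyHullBound 2 K, y 0 ≠ 0)
    (h1 : ∀ y ∈ polyHullBound 2 K, y 1 ≠ 0) :
    ∃ c : ℂ, ‖c‖ = 1 ∧ z 0 = c * z 1 ∧
      z 1 ∈ planarHull ((fun x => x 1) '' {x | x ∈ K ∧ x 0 = c * x 1}) := by
  have hsub : K ⊆ polyHullBound 2 K := fun x hx p C hC => hC x hx
  have hhull : polyHullBound 2 (insert z K) ⊆ polyHullBound 2 K := fun y hy p C hC =>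
    hy p C (by
      rintro x (rfl | hx)
      · exact hz p C hC
      · exact hC x hx)
  have : CompactSpace ↥(insert z K) := isCompact_iff_compactSpace.1 (hK.insert z)
  have hne : (insert z K).Nonempty := ⟨z, Set.mem_insert _ _⟩
  obtain ⟨g0, hg0, hg0'⟩ := exists_inv_mem_polyAlg hne 0 fun y hy => h0 y (hhull hy)
  obtain ⟨g1, hg1, hg1'⟩ := exists_inv_mem_polyAlg hne 1 fun y hy => h1 y (hhull hy)
  let Z (i : Fin 2) : C(↥(insert z K), ℂ) := polyRestrict 2 (insert z K) (MvPolynomial.X i)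
  have hZ (i x) : Z i x = x.1 i := by simp [Z, polyRestrict_apply]
  have hZm (i) : Z i ∈ polyAlg 2 (insert z K) := polyRestrict_mem_polyAlg _
  have hval (x : ↥(insert z K)) : (Z 0 * g1) x = x.1 0 / x.1 1 := by
    have h3 : x.1 1 ≠ 0 := fun h => by have := hg1' x; simp [h] at this
    rw [ContinuousMap.mul_apply, hZ, eq_div_iff h3, mul_assoc, mul_comm (g1 x), hg1', mul_one]
  have hval' (x : ↥(insert z K)) : (Z 1 * g0) x = x.1 1 / x.1 0 := by
    have h3 : x.1 0 ≠ 0 := fun h => by have := hg0' x; simp [h] at this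
    rw [ContinuousMap.mul_apply, hZ, eq_div_iff h3, mul_assoc, mul_comm (g0 x), hg0', mul_one]
  have hz0 := h0 z hz
  have hz1 := h1 z hz
  have hu : ‖z 0 / z 1‖ ≤ 1 := by
    rw [← hval ⟨z, Set.mem_insert _ _⟩]
    refine norm_le_of_mem_polyAlg hz (mul_mem (hZm 0) hg1) fun x hx => ?_
    rw [hval, norm_div]
    exact div_le_one_of_le₀ (hKM x hx).le (norm_nonneg _)
  have hu' : ‖z 1 / z 0‖ ≤ 1 := by
    rw [← hval' ⟨z, Set.mem_insert _ _⟩]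
    refine norm_le_of_mem_polyAlg hz (mul_mem (hZm 1) hg0) fun x hx => ?_
    rw [hval', norm_div]
    exact div_le_one_of_le₀ (hKM x hx).ge (norm_nonneg _)
  set c := z 0 / z 1 with hc
  have hc1 : ‖c‖ = 1 := by
    rw [norm_div, div_le_one (norm_pos_iff.2 (by assumption))] at hu hu'
    rw [hc, norm_div, le_antisymm hu hu', div_self (norm_ne_zero_iff.2 hz1)]
  have hcc : (starRingEnd ℂ) c * c = 1 := by
    rw [← Complex.normSq_eq_conj_mul_self, Complex.normSq_eq_norm_sq, hc1]; simp
  have hcz : z 0 = c * z 1 := by rw [hc]; field_simp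
  refine ⟨c, hc1, hcz, ?_⟩
  let h : C(↥(insert z K), ℂ) := (1 / 2 : ℂ) • (1 + (starRingEnd ℂ) c • (Z 0 * g1))
  have hh (x : ↥(insert z K)) : h x = 1 / 2 * (1 + (starRingEnd ℂ) c * (x.1 0 / x.1 1)) := by
    simp only [h, ContinuousMap.smul_apply, ContinuousMap.add_apply, hval, smul_eq_mul,
      ContinuousMap.one_apply]
  have hhm : h ∈ polyAlg 2 (insert z K) :=
    Subalgebra.smul_mem _ (add_mem (one_mem _) (Subalgebra.smul_mem _ (mul_mem (hZm 0) hg1) _)) _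
  have hhz : h ⟨z, Set.mem_insert _ _⟩ = 1 := by
    rw [hh]
    change 1 / 2 * (1 + (starRingEnd ℂ) c * c) = 1
    rw [hcc]; norm_num
  have hunit (x) (hx : x ∈ K) : ‖(starRingEnd ℂ) c * (x 0 / x 1)‖ = 1 := by
    rw [norm_mul, RCLike.norm_conj, hc1, norm_div, hKM x hx,
      div_self (norm_ne_zero_iff.2 (h1 x (hsub hx))), one_mul]
  have hh1 (x) (hx : x ∈ K) : ‖h ⟨x, Set.mem_insert_of_mem _ hx⟩‖ ≤ 1 := by
    rw [hh, norm_mul]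
    have := norm_add_le 1 ((starRingEnd ℂ) c * (x 0 / x 1))
    rw [hunit x hx] at this
    norm_num at this ⊢
    linarith
  have hheq (x) (hx : x ∈ K) (hn : ‖h ⟨x, Set.mem_insert_of_mem _ hx⟩‖ = 1) :
      x 0 = c * x 1 := by
    rw [hh, norm_mul] at hn
    have h5 := hunit x hx
    have hv : (starRingEnd ℂ) c * (x 0 / x 1) = 1 := by
      dsimp only at hn
      generalize (starRingEnd ℂ) c * (x 0 / x 1) = v at *
      have h6 : ‖1 + v‖ = 2 := by
        norm_num at hn
        linarith
      have e1 : v.re ^ 2 + v.im ^ 2 = 1 := by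
        have := Complex.sq_norm v
        rw [h5, Complex.normSq_apply] at this
        linarith
      have e2 : (1 + v.re) ^ 2 + v.im ^ 2 = 4 := by
        have := Complex.sq_norm (1 + v)
        rw [h6, Complex.normSq_apply] at this
        simp at this
        linarith
      have e3 : v.re = 1 := by linarith
      have e4 : v.im = 0 := by
        rw [e3] at e1
        nlinarith
      exact Complex.ext e3 e4
    have hx1 := h1 x (hsub hx)
    have : x 0 / x 1 = c := by
      linear_combination c * hv - (x 0 / x 1) * hcc
    rw [← this]
    field_simp
  obtain ⟨x₀, hx₀, hx₀'⟩ : ∃ x ∈ K, x 0 = c * x 1 := by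
    by_contra! hcon
    have := norm_le_of_peak hK hz (one_mem (polyAlg 2 (insert z K))) hhm hhz hh1 le_rfl
      fun x hx hn => absurd (hheq x hx hn) (hcon x hx)
    norm_num at this
  intro q C hC
  have hCx : ∀ x ∈ K, x 0 = c * x 1 → ‖q.eval (x 1)‖ ≤ C := fun x hx hxc =>
    hC _ ⟨x, ⟨hx, hxc⟩, rfl⟩
  have := norm_le_of_peak hK hz
    (polyRestrict_mem_polyAlg (Polynomial.aeval (MvPolynomial.X 1) q)) hhm hhz hh1
    ((norm_nonneg _).trans (hCx x₀ hx₀ hx₀')) (C := C) fun x hx hn => by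
      rw [polyRestrict_apply, eval_aeval_X]
      exact hCx x hx (hheq x hx hn)
  rwa [polyRestrict_apply, eval_aeval_X] at this

theorem exists_retraction_closedBall : ∃ ρ : ℝ × ℝ → ℝ × ℝ, Continuous ρ ∧
    (∀ x, ρ x ∈ Metric.closedBall (0 : ℝ × ℝ) 1) ∧
    ∀ x ∈ Metric.closedBall (0 : ℝ × ℝ) 1, ρ x = x := by
  have h (t : ℝ) : |max (-1) (min 1 t)| ≤ 1 := by
    refine abs_le.2 ⟨le_max_left _ _, max_le (by norm_num) (min_le_left _ _)⟩
  refine ⟨fun x => (max (-1) (min 1 x.1), max (-1) (min 1 x.2)), by fun_prop, fun x => ?_,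
    fun x hx => ?_⟩
  · simpa [Prod.norm_def] using ⟨h x.1, h x.2⟩
  · simp only [mem_closedBall_zero_iff, Prod.norm_def, Real.norm_eq_abs, sup_le_iff, abs_le] at hx
    obtain ⟨⟨h1, h2⟩, h3, h4⟩ := hx
    simp [*]

theorem exists_continuous_log_closedBall {F : ℝ × ℝ → ℂ}
    (hF : ContinuousOn F (Metric.closedBall 0 1)) (h0 : ∀ x ∈ Metric.closedBall 0 1, F x ≠ 0) :
    ∃ l : ℝ × ℝ → ℂ, Continuous l ∧ ∀ x ∈ Metric.closedBall 0 1, Complex.exp (l x) = F x := by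
  obtain ⟨ρ, hρ, hρm, hρe⟩ := exists_retraction_closedBall
  obtain ⟨l, hl, h⟩ := exists_continuous_log (fun x => F (ρ x))
    (hF.comp_continuous hρ hρm) fun x => h0 _ (hρm x)
  exact ⟨l, hl, fun x hx => by rw [h, hρe x hx]⟩

/-- Level sets of a sweep of the disc with transverse planes are planarly convex. -/
theorem planarHull_level_subset {θ : ℝ × ℝ → ℝ} {W : ℝ × ℝ → ℂ} (hθ : Continuous θ)
    (hW : ContinuousOn W (Metric.closedBall 0 1))
    (hY : HasTransversePlanes ((fun x => (θ x, W x)) '' Metric.closedBall 0 1)) (t₀ : ℝ)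
    (hinj : Set.InjOn W {x | x ∈ Metric.closedBall 0 1 ∧ ∃ k : ℤ, θ x = t₀ + k * (2 * Real.pi)}) :
    planarHull (W '' {x | x ∈ Metric.closedBall 0 1 ∧ ∃ k : ℤ, θ x = t₀ + k * (2 * Real.pi)}) ⊆
      W '' {x | x ∈ Metric.closedBall 0 1 ∧ ∃ k : ℤ, θ x = t₀ + k * (2 * Real.pi)} := by
  intro a ha
  by_contra haX
  have hD : IsCompact (Metric.closedBall (0 : ℝ × ℝ) 1) := isCompact_closedBall _ _
  set E := {x | x ∈ Metric.closedBall (0 : ℝ × ℝ) 1 ∧ ∃ k : ℤ, θ x = t₀ + k * (2 * Real.pi)}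
    with hE
  have hED : E ⊆ Metric.closedBall 0 1 := fun x hx => hx.1
  have hEc : IsCompact E := by
    have : E = Metric.closedBall 0 1 ∩
        (fun x => (θ x - t₀) / (2 * Real.pi)) ⁻¹' Set.range ((↑) : ℤ → ℝ) := by
      ext x
      refine and_congr_right fun _ => exists_congr fun k => ?_
      rw [eq_div_iff (by positivity)]
      constructor <;> intro h <;> linarith
    rw [this]
    exact hD.inter_right (Int.isClosedEmbedding_coe_real.isClosed_range.preimage (by fun_prop))
  have hlog (k : ℤ) : ∃ l : ℝ × ℝ → ℂ, Continuous l ∧ ∀ x ∈ Metric.closedBall 0 1,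
      θ x = t₀ + k * (2 * Real.pi) → Complex.exp (l x) = W x - a := by
    have hnot : (t₀ + k * (2 * Real.pi), a) ∉ (fun x => (θ x, W x)) '' Metric.closedBall 0 1 := by
      rintro ⟨x, hx, h⟩
      exact haX ⟨x, ⟨hx, k, congrArg Prod.fst h⟩, congrArg Prod.snd h⟩
    obtain ⟨γ, hγ, h0, hav⟩ := hY.exists_path (hD.image_of_continuousOn
      (hθ.continuousOn.prodMk hW)) hnot
    obtain ⟨l, hl, h⟩ := exists_continuous_log_closedBall (F := fun x => W x - γ (θ x))
      (hW.sub (by fun_prop)) fun x hx h => hav (θ x) ⟨x, hx, by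
        rw [← sub_eq_zero.1 h]⟩
    exact ⟨l, hl, fun x hx hxk => by rw [h x hx, hxk, h0]⟩
  choose l hl hlW using hlog
  choose κ hκ using fun x : E => x.2.2
  have hκc : Continuous κ := by
    refine Int.isClosedEmbedding_coe_real.continuous_iff.2 ?_
    have : ((↑) : ℤ → ℝ) ∘ κ = fun x : E => (θ x - t₀) / (2 * Real.pi) := by
      ext x
      have := hκ x
      simp only [Function.comp]
      rw [eq_div_iff (by positivity)]
      linarith
    rw [this]
    fun_prop
  have hlc : Continuous (Function.uncurry l) := continuous_prod_of_discrete_left.2 hl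
  have : CompactSpace E := isCompact_iff_compactSpace.1 hEc
  have hemb : Topology.IsClosedEmbedding (fun x : E => W x) :=
    (continuousOn_iff_continuous_domRestrict.1 (hW.mono hED)).isClosedEmbedding
      (Set.injOn_iff_injective.1 hinj)
  obtain ⟨u, hu⟩ := ContinuousMap.exists_extension' hemb
    (⟨fun x : E => Function.uncurry l (κ x, x), by fun_prop⟩ : C(E, ℂ))
  refine no_log_of_mem_planarHull (hEc.image_of_continuousOn (hW.mono hED)) ha u u.continuous ?_
  rintro _ ⟨x, hx, rfl⟩
  have : u (W x) = l (κ ⟨x, hx⟩) x := congrFun hu ⟨x, hx⟩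
  rw [this, hlW _ x hx.1 (hκ ⟨x, hx⟩)]

theorem exists_forall_dist_lt_mem {X Z : Type*} [TopologicalSpace X] [MetricSpace Z] {D : Set X}
    (hD : IsCompact D) {Ψ : X → Z} (hΨ : ContinuousOn Ψ D) (hinj : Set.InjOn Ψ D) {x : X}
    (hx : x ∈ D) {N : Set X} (hN : N ∈ nhds x) :
    ∃ δ > 0, ∀ u ∈ D, dist (Ψ u) (Ψ x) < δ → u ∈ N := by
  have hc : IsCompact (D \ interior N) := hD.diff isOpen_interior
  have hcl : IsClosed (Ψ '' (D \ interior N)) :=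
    (hc.image_of_continuousOn (hΨ.mono Set.sdiff_subset)).isClosed
  have hnot : Ψ x ∉ Ψ '' (D \ interior N) := by
    rintro ⟨u, ⟨huD, huN⟩, h⟩
    exact huN (hinj huD hx h ▸ mem_interior_iff_mem_nhds.2 hN)
  obtain ⟨δ, hδ, hball⟩ := Metric.isOpen_iff.1 hcl.isOpen_compl _ hnot
  refine ⟨δ, hδ, fun u hu hd => ?_⟩
  by_contra huN
  exact hball hd ⟨u, ⟨hu, fun h => huN (interior_subset h)⟩, rfl⟩

open Topology in
theorem hasTransversePlanes_image {D : Set (ℝ × ℝ)} (hD : IsCompact D) {θ : ℝ × ℝ → ℝ}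
    {W : ℝ × ℝ → ℂ} (hθ : ContinuousOn θ D) (hW : ContinuousOn W D)
    (hinj : Set.InjOn (fun x => (θ x, W x)) D)
    (hloc : ∀ x ∈ D, ∃ (θ' : ℝ × ℝ → ℝ) (dθ : ℝ × ℝ →L[ℝ] ℝ) (dW : ℝ × ℝ →L[ℝ] ℂ),
      HasStrictFDerivAt θ' dθ x ∧ HasStrictFDerivAt W dW x ∧ (∀ᶠ u in 𝓝 x, u ∈ D → θ u = θ' u) ∧
      dθ ≠ 0 ∧ ∀ v, dθ v = 0 → dW v = 0 → v = 0) :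
    HasTransversePlanes ((fun x => (θ x, W x)) '' D) := by
  rintro _ ⟨x, hx, rfl⟩
  obtain ⟨θ', dθ, dW, hθ', hW', heq, hne, hker⟩ := hloc x hx
  obtain ⟨v₁, hv₁⟩ : ∃ v₁, dθ v₁ = 1 := by
    obtain ⟨v, hv⟩ := DFunLike.ne_iff.1 hne
    exact ⟨(dθ v)⁻¹ • v, by simpa using inv_mul_cancel₀ hv⟩
  set A := dθ (1, 0) with hA
  set B := dθ (0, 1) with hB
  have hdθ (v : ℝ × ℝ) : dθ v = v.1 * A + v.2 * B := by
    have : v = v.1 • ((1, 0) : ℝ × ℝ) + v.2 • ((0, 1) : ℝ × ℝ) := by ext <;> simp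
    conv_lhs => rw [this]
    rw [map_add, map_smul, map_smul]
    rfl
  have hAB : A ^ 2 + B ^ 2 ≠ 0 := fun h => by
    have h1 : A = 0 := by nlinarith
    have h2 : B = 0 := by nlinarith
    rw [hdθ, h1, h2] at hv₁
    simp at hv₁
  set α := dW v₁
  set b := dW (B, -A) with hb
  have hb0 : b ≠ 0 := fun h => by
    have := hker (B, -A) (by rw [hdθ]; ring) h
    rw [Prod.mk_eq_zero] at this
    exact hAB (by rw [this.1, neg_eq_zero.1 this.2]; simp)
  have hlin (v : ℝ × ℝ) : ((dW v - dθ v * α) / b).im = 0 := by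
    set v' := v - dθ v • v₁ with hv'
    have h0 : dθ v' = 0 := by simp [hv', hv₁]
    obtain ⟨s, hs⟩ : ∃ s : ℝ, v' = s • ((B, -A) : ℝ × ℝ) := by
      refine ⟨(v'.1 * B - v'.2 * A) / (A ^ 2 + B ^ 2), ?_⟩
      rw [hdθ] at h0
      ext
      · simp only [Prod.smul_mk, smul_eq_mul]
        field_simp
        linear_combination A * h0
      · simp only [Prod.smul_mk, smul_eq_mul]
        field_simp
        linear_combination B * h0
    have h1 : dW v - dθ v * α = s * b := by
      have : dW v' = s • b := by rw [hs, map_smul]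
      rw [hv', map_sub, map_smul] at this
      simpa using this
    rw [h1, mul_div_assoc, div_self hb0]
    simp
  have hΨ := hθ'.prodMk hW'
  obtain ⟨c, hc, hanti⟩ := LinearMap.exists_antilipschitzWith (dθ.prod dW).toLinearMap (by
    rw [LinearMap.ker_eq_bot']
    intro v hv
    have h2 := Prod.mk_eq_zero.1 (show (dθ v, dW v) = 0 from hv)
    exact hker v h2.1 h2.2)
  have hanti' (v : ℝ × ℝ) : ‖v‖ ≤ c * ‖(dθ v, dW v)‖ := by
    have := hanti.le_mul_dist v 0
    simp only [dist_zero_right, map_zero] at this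
    exact this
  set m := (‖α‖ + 1) / ‖b‖ with hm
  have hm0 : 0 < m := by positivity
  have hfun (y : ℝ × ℂ) : |((y.2 - y.1 * α) / b).im| ≤ m * ‖y‖ := by
    refine (Complex.abs_im_le_norm _).trans ?_
    rw [norm_div, hm, div_mul_eq_mul_div]
    gcongr
    refine (norm_sub_le _ _).trans ?_
    rw [norm_mul, Complex.norm_real]
    have h1 := norm_fst_le y
    have h2 := norm_snd_le y
    have := norm_nonneg α
    nlinarith
  refine ⟨α, b, hb0, fun ε hε => ?_⟩
  have hc' : (0 : ℝ) < c := hc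
  set η : ℝ := min (1 / (2 * (c : ℝ))) (ε / (2 * c * m)) with hη
  have hη0 : 0 < η := by positivity
  have hlo := hΨ.isLittleO.def hη0
  obtain ⟨N, hN, hNN⟩ := Filter.eventually_prod_self_iff'.1 (nhds_prod_eq (x := x) (y := x) ▸ hlo)
  obtain ⟨δ, hδ, hδN⟩ := exists_forall_dist_lt_mem hD (hθ.prodMk hW) hinj hx
    (Filter.inter_mem hN heq)
  refine ⟨δ, hδ, ?_⟩
  rintro _ ⟨u, hu, rfl⟩ _ ⟨w, hw, rfl⟩ hud hwd
  obtain ⟨huN, huθ⟩ := hδN u hu hud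
  obtain ⟨hwN, hwθ⟩ := hδN w hw hwd
  have hest := hNN u huN w hwN
  dsimp only at hest ⊢
  rw [← huθ hu, ← hwθ hw] at hest
  set Δ := ((θ u, W u) - (θ w, W w) : ℝ × ℂ) with hΔ
  change ‖Δ - (dθ (u - w), dW (u - w))‖ ≤ η * ‖u - w‖ at hest
  have h1 : ‖u - w‖ ≤ 2 * c * ‖Δ‖ := by
    have h2 := hanti' (u - w)
    have h3 := norm_sub_norm_le (dθ (u - w), dW (u - w)) Δ
    rw [norm_sub_rev _ Δ] at h3
    have h4 : c * (η * ‖u - w‖) ≤ 1 / 2 * ‖u - w‖ := by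
      rw [← mul_assoc]
      gcongr
      calc c * η ≤ c * (1 / (2 * c)) := by gcongr; exact min_le_left _ _
        _ = 1 / 2 := by field_simp
    have h5 : c * ‖(dθ (u - w), dW (u - w))‖ ≤ c * (‖Δ‖ + η * ‖u - w‖) := by
      gcongr
      linarith
    linarith
  have h2 : ((W u - W w - (θ u - θ w) * α) / b).im =
      (((Δ - (dθ (u - w), dW (u - w))).2 -
        ((Δ - (dθ (u - w), dW (u - w))).1 : ℝ) * α) / b).im := by
    have h3 := hlin (u - w)
    rw [← sub_zero ((W u - W w - (θ u - θ w) * α) / b).im, ← h3, ← Complex.sub_im]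
    congr 1
    simp only [hΔ, Prod.snd_sub, Prod.fst_sub]
    push_cast
    ring
  rw [h2]
  calc _ ≤ m * ‖Δ - (dθ (u - w), dW (u - w))‖ := hfun _
    _ ≤ m * (η * (2 * c * ‖Δ‖)) := by
      gcongr
      exact hest.trans (by gcongr)
    _ ≤ m * (ε / (2 * c * m) * (2 * c * ‖Δ‖)) := by gcongr; exact min_le_right _ _
    _ = ε * ‖Δ‖ := by field_simp

open Topology in
theorem exists_strict_angle {φ : ℝ × ℝ → Fin 2 → ℂ} {x : ℝ × ℝ} {φ' : ℝ × ℝ →L[ℝ] (Fin 2 → ℂ)}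
    (hφ : HasStrictFDerivAt φ φ' x) (hinj : Function.Injective φ')
    (htr : ∀ v w, φ' v = Complex.I • φ' w → φ' v = 0) {D : Set (ℝ × ℝ)}
    (hD : UniqueDiffWithinAt ℝ D x) (hx : x ∈ D) (hn : ∀ u ∈ D, ‖φ u 0‖ = ‖φ u 1‖)
    (h1 : φ x 1 ≠ 0) {l : ℝ × ℝ → ℂ} (hl : ContinuousAt l x)
    (hle : ∀ u ∈ D, Complex.exp (l u) = φ u 0 / φ u 1) :
    ∃ (θ' : ℝ × ℝ → ℝ) (dθ : ℝ × ℝ →L[ℝ] ℝ) (dW : ℝ × ℝ →L[ℝ] ℂ),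
      HasStrictFDerivAt θ' dθ x ∧ HasStrictFDerivAt (fun u => φ u 1) dW x ∧
      (∀ᶠ u in 𝓝 x, u ∈ D → (l u).im = θ' u) ∧
      dθ ≠ 0 ∧ ∀ v, dθ v = 0 → dW v = 0 → v = 0 := by
  have h0 : φ x 0 ≠ 0 := by rw [← norm_ne_zero_iff, hn x hx]; simpa
  have hpi := hasStrictFDerivAt_pi'.1 hφ
  have hlog (i : Fin 2) (hi : φ x i ≠ 0) :
      HasStrictFDerivAt (fun u => Complex.log (φ u i / φ x i))
        ((φ x i)⁻¹ • (ContinuousLinearMap.proj (R := ℝ) i).comp φ') x := by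
    have ha : HasStrictFDerivAt (fun u => φ u i / φ x i)
        ((φ x i)⁻¹ • (ContinuousLinearMap.proj (R := ℝ) i).comp φ') x := by
      simpa only [div_eq_inv_mul] using (hpi i).const_mul (φ x i)⁻¹
    have hb := Complex.hasStrictDerivAt_log (x := φ x i / φ x i) (by simp [div_self hi])
    simpa [div_self hi, Function.comp_def] using hb.comp_hasStrictFDerivAt x ha
  have hΛ := (hlog 0 h0).sub (hlog 1 h1)
  set Λ : ℝ × ℝ → ℂ := (fun u => Complex.log (φ u 0 / φ x 0)) -
    fun u => Complex.log (φ u 1 / φ x 1) with hΛdef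
  set dΛ := (φ x 0)⁻¹ • (ContinuousLinearMap.proj (R := ℝ) 0).comp φ' -
    (φ x 1)⁻¹ • (ContinuousLinearMap.proj (R := ℝ) 1).comp φ' with hdΛ
  have hdz (v) : φ' v 0 = φ x 0 / φ x 1 * φ' v 1 + φ x 0 * dΛ v := by
    have : dΛ v = (φ x 0)⁻¹ * φ' v 0 - (φ x 1)⁻¹ * φ' v 1 := rfl
    rw [this]
    field_simp
    ring
  have hre : ∀ u ∈ D, (Λ u).re = 0 := fun u hu => by
    simp [hΛdef, Complex.log_re, hn u hu, hn x hx]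
  have hdre (v) : (dΛ v).re = 0 := by
    have ha := (Complex.reCLM.hasStrictFDerivAt.comp x hΛ).hasFDerivAt.hasFDerivWithinAt (s := D)
    have hb : HasFDerivWithinAt (Complex.reCLM ∘ Λ) (0 : ℝ × ℝ →L[ℝ] ℝ) D x :=
      (hasFDerivWithinAt_const (0 : ℝ) x D).congr (fun u hu => hre u hu) (hre x hx)
    exact DFunLike.congr_fun (hD.eq ha hb) v
  have hΛx : Λ x = 0 := by simp [hΛdef, div_self h0, div_self h1]
  refine ⟨fun u => (l x).im + (Λ u).im, Complex.imCLM.comp dΛ,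
    (ContinuousLinearMap.proj (R := ℝ) 1).comp φ',
    (Complex.imCLM.hasStrictFDerivAt.comp x hΛ).const_add _, hpi 1, ?_, ?_, ?_⟩
  · have ha : ∀ᶠ u in 𝓝 x, |(Λ u).im| < Real.pi := by
      have : ContinuousAt (fun u => |(Λ u).im|) x :=
        (Complex.continuous_im.continuousAt.comp hΛ.hasFDerivAt.continuousAt).abs
      exact this.eventually_lt_const (by simp [hΛx, Real.pi_pos])
    have hb : ∀ᶠ u in 𝓝 x, |(l u - l x).im| < Real.pi := by
      have : ContinuousAt (fun u => |(l u - l x).im|) x :=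
        (Complex.continuous_im.continuousAt.comp (hl.sub continuousAt_const)).abs
      exact this.eventually_lt_const (by simp [Real.pi_pos])
    have hc : ∀ᶠ u in 𝓝 x, φ u 1 ≠ 0 := (hpi 1).hasFDerivAt.continuousAt.eventually_ne h1
    filter_upwards [ha, hb, hc] with u ha hb hc hu
    have hc0 : φ u 0 ≠ 0 := by rw [← norm_ne_zero_iff, hn u hu]; simpa
    have hexp : Complex.exp (Λ u) = Complex.exp (l u - l x) := by
      simp only [hΛdef, Pi.sub_apply]
      rw [Complex.exp_sub, Complex.exp_sub, Complex.exp_log (div_ne_zero hc0 h0),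
        Complex.exp_log (div_ne_zero hc h1), hle u hu, hle x hx]
      field_simp
    have h := congrArg Complex.log hexp
    rw [Complex.log_exp (abs_lt.1 ha).1 (abs_lt.1 ha).2.le,
      Complex.log_exp (abs_lt.1 hb).1 (abs_lt.1 hb).2.le] at h
    simp [h]
  · intro h
    have hz (v) : φ' v 0 = φ x 0 / φ x 1 * φ' v 1 := by
      have : dΛ v = 0 := Complex.ext (hdre v) (DFunLike.congr_fun h v)
      rw [hdz, this, mul_zero, add_zero]
    have hext {v : ℝ × ℝ} {y : Fin 2 → ℂ} (hy : y 0 = φ x 0 / φ x 1 * y 1)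
        (h : φ' v 1 = y 1) : φ' v = y := by
      ext i
      fin_cases i
      · exact (hz v).trans (by rw [h]; exact hy.symm)
      · exact h
    have hwi : Function.Injective
        ((ContinuousLinearMap.proj (R := ℝ) 1).comp φ' : ℝ × ℝ →L[ℝ] ℂ).toLinearMap :=
      fun v w hvw => hinj (hext (hz w) hvw)
    have hws := (LinearMap.injective_iff_surjective_of_finrank_eq_finrank
      (by simp [Complex.finrank_real_complex])).1 hwi
    obtain ⟨v, hv⟩ := hws (Complex.I * φ' (1, 0) 1)
    have hva : φ' v = Complex.I • φ' (1, 0) := hext (by simp [hz (1, 0)]; ring) (by simpa using hv)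
    have hv0 := htr _ _ hva
    rw [hva, smul_eq_zero_iff_right Complex.I_ne_zero] at hv0
    have := hinj (hv0.trans (map_zero φ').symm)
    simp at this
  · intro v hθ hw
    have hΛ0 : dΛ v = 0 := Complex.ext (hdre v) hθ
    have hw' : φ' v 1 = 0 := hw
    have hz := hdz v
    rw [hw', hΛ0, mul_zero, mul_zero, add_zero] at hz
    refine hinj (Eq.trans ?_ (map_zero φ').symm)
    ext i
    fin_cases i
    · exact hz
    · exact hw'

theorem polyHull_eq_polyHullBound {n : ℕ} {K : Set (Fin n → ℂ)} (hK : IsCompact K)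
    (hne : K.Nonempty) : polyHull n K = polyHullBound n K := by
  ext z
  refine forall_congr' fun p => ⟨fun h C hC => h.trans (csSup_le (hne.image _) ?_), fun h => h _ ?_⟩
  · rintro _ ⟨w, hw, rfl⟩
    exact hC w hw
  · exact fun w hw => le_csSup (hK.image (p.continuous_eval.norm)).bddAbove ⟨w, hw, rfl⟩

/-- A totally real disc in `{|z| = |w| ≠ 0}` contains every point `(c w₀, w₀)` for which `w₀` lies
in the hull of its slice by the line `z = c w`. -/
theorem mem_of_mem_planarHull_slice {U : Set (ℝ × ℝ)} {φ : ℝ × ℝ → Fin 2 → ℂ} (hU : IsOpen U)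
    (hDU : Metric.closedBall (0 : ℝ × ℝ) 1 ⊆ U) (hφ : ContDiffOn ℝ 2 φ U) (hinj : Set.InjOn φ U)
    (himm : ∀ x ∈ U, Function.Injective (fderiv ℝ φ x))
    (htr : ∀ x ∈ U, ∀ v w : ℝ × ℝ,
      fderiv ℝ φ x v = Complex.I • fderiv ℝ φ x w → fderiv ℝ φ x v = 0)
    (hn : ∀ x ∈ Metric.closedBall (0 : ℝ × ℝ) 1, ‖φ x 0‖ = ‖φ x 1‖)
    (h1 : ∀ x ∈ Metric.closedBall (0 : ℝ × ℝ) 1, φ x 1 ≠ 0) {c : ℂ} (hc : ‖c‖ = 1)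
    {z : Fin 2 → ℂ} (hz : z 0 = c * z 1)
    (hzh : z 1 ∈ planarHull ((fun x => x 1) ''
      {x | x ∈ φ '' Metric.closedBall (0 : ℝ × ℝ) 1 ∧ x 0 = c * x 1})) :
    z ∈ φ '' Metric.closedBall (0 : ℝ × ℝ) 1 := by
  have h0 : ∀ x ∈ Metric.closedBall (0 : ℝ × ℝ) 1, φ x 0 ≠ 0 := fun x hx => by
    rw [← norm_ne_zero_iff, hn x hx, norm_ne_zero_iff]
    exact h1 x hx
  have hcont (i : Fin 2) : ContinuousOn (fun x => φ x i) (Metric.closedBall 0 1) :=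
    (continuous_apply i).comp_continuousOn (hφ.continuousOn.mono hDU)
  obtain ⟨l, hl, hle⟩ := exists_continuous_log_closedBall
    (F := fun x => φ x 0 / φ x 1) ((hcont 0).div (hcont 1) h1) fun x hx =>
      div_ne_zero (h0 x hx) (h1 x hx)
  have hlim : ∀ x ∈ Metric.closedBall (0 : ℝ × ℝ) 1, l x = (l x).im * Complex.I := fun x hx => by
    have : Real.exp (l x).re = 1 := by
      rw [← Complex.norm_exp, hle x hx, norm_div, hn x hx, div_self (norm_ne_zero_iff.2 (h1 x hx))]
    rw [Real.exp_eq_one_iff] at this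
    exact Complex.ext (by simp [this]) (by simp)
  have hφz : ∀ x ∈ Metric.closedBall (0 : ℝ × ℝ) 1,
      φ x 0 = Complex.exp ((l x).im * Complex.I) * φ x 1 := fun x hx => by
    rw [← hlim x hx, hle x hx, div_mul_cancel₀ _ (h1 x hx)]
  have hΨinj : Set.InjOn (fun x => ((l x).im, φ x 1)) (Metric.closedBall 0 1) := by
    intro x hx y hy hxy
    obtain ⟨hθ, hW⟩ := Prod.mk_inj.1 hxy
    refine hinj (hDU hx) (hDU hy) ?_
    ext i
    fin_cases i
    · exact (hφz x hx).trans (by rw [hθ, hW]; exact (hφz y hy).symm)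
    · exact hW
  have hθc : Continuous fun x => (l x).im := Complex.continuous_im.comp hl
  have hY := hasTransversePlanes_image (isCompact_closedBall (0 : ℝ × ℝ) 1) hθc.continuousOn
    (hcont 1) hΨinj fun x hx => exists_strict_angle
      ((hφ.contDiffAt (hU.mem_nhds (hDU hx))).hasStrictFDerivAt two_ne_zero) (himm x (hDU hx))
      (htr x (hDU hx))
      (uniqueDiffOn_convex (convex_closedBall 0 1)
        ⟨0, Metric.ball_subset_interior_closedBall (Metric.mem_ball_self one_pos)⟩ x hx)
      hx hn (h1 x hx) hl.continuousAt hle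
  have hct : Complex.exp (c.arg * Complex.I) = c := by
    simpa [hc] using Complex.norm_mul_exp_arg_mul_I c
  have hlevel : ∀ x ∈ Metric.closedBall (0 : ℝ × ℝ) 1,
      (φ x 0 = c * φ x 1 ↔ ∃ k : ℤ, (l x).im = c.arg + k * (2 * Real.pi)) := fun x hx => by
    rw [hφz x hx, mul_left_inj' (h1 x hx), ← hct, Complex.exp_eq_exp_iff_exists_int, hct]
    refine exists_congr fun k => ?_
    rw [show (c.arg * Complex.I + k * (2 * Real.pi * Complex.I) : ℂ) =
      ((c.arg + k * (2 * Real.pi) : ℝ) : ℂ) * Complex.I by push_cast; ring,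
      mul_left_inj' Complex.I_ne_zero, Complex.ofReal_inj]
  have hslice : (fun x : Fin 2 → ℂ => x 1) ''
      {x | x ∈ φ '' Metric.closedBall (0 : ℝ × ℝ) 1 ∧ x 0 = c * x 1} =
      (fun x => φ x 1) '' {x | x ∈ Metric.closedBall (0 : ℝ × ℝ) 1 ∧
        ∃ k : ℤ, (l x).im = c.arg + k * (2 * Real.pi)} := by
    ext w
    constructor
    · rintro ⟨_, ⟨⟨x, hx, rfl⟩, h⟩, rfl⟩
      exact ⟨x, ⟨hx, (hlevel x hx).1 h⟩, rfl⟩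
    · rintro ⟨x, ⟨hx, h⟩, rfl⟩
      exact ⟨φ x, ⟨⟨x, hx, rfl⟩, (hlevel x hx).2 h⟩, rfl⟩
  rw [hslice] at hzh
  obtain ⟨x, ⟨hx, hk⟩, hxz⟩ := planarHull_level_subset hθc (hcont 1) hY c.arg (by
    rintro x ⟨hx, hxk⟩ y ⟨hy, hyk⟩ hxy
    refine hinj (hDU hx) (hDU hy) ?_
    ext i
    fin_cases i
    · exact ((hlevel x hx).2 hxk).trans 
        ((congrArg (c * ·) hxy).trans ((hlevel y hy).2 hyk).symm)
    · exact hxy) hzh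
  refine ⟨x, hx, ?_⟩
  ext i
  fin_cases i
  · exact ((hlevel x hx).2 hk).trans (by rw [show φ x 1 = z 1 from hxz]; exact hz.symm)
  · exact hxz

/-- A totally real `C²`-smooth disc `K` contained in
`{(z,w) : |z| = |w|} ∖ {(0,0)}` is polynomially convex iff
`K̂ ∩ {zw = 0} = ∅`. -/
theorem totallyRealDisc_in_cone_polyConvex_iff
    (M : Set (Fin 2 → ℂ))
    (hM : M = {z : Fin 2 → ℂ | ‖z 0‖ = ‖z 1‖} \ {0})
    (K : Set (Fin 2 → ℂ)) (hK : TotallyRealDisc 2 K) (hKM : K ⊆ M) :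
    PolyConvex 2 K ↔ polyHull 2 K ∩ {z : Fin 2 → ℂ | z 0 * z 1 = 0} = ∅ := by
  subst hM
  have hn : ∀ x ∈ K, ‖x 0‖ = ‖x 1‖ := fun x hx => (hKM hx).1
  have h1 : ∀ x ∈ K, x 1 ≠ 0 := fun x hx h => (hKM hx).2 <| by
    have h0 : x 0 = 0 := by rw [← norm_eq_zero, hn x hx, h, norm_zero]
    ext i
    fin_cases i
    · exact h0
    · exact h
  have h0 : ∀ x ∈ K, x 0 ≠ 0 := fun x hx => by
    rw [← norm_ne_zero_iff, hn x hx, norm_ne_zero_iff]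
    exact h1 x hx
  obtain ⟨U, φ, hU, hDU, hφ, hinj, himm, htr, rfl⟩ := hK
  set K := φ '' Metric.closedBall (0 : ℝ × ℝ) 1
  have hKc : IsCompact K :=
    (isCompact_closedBall _ _).image_of_continuousOn (hφ.continuousOn.mono hDU)
  have hKne : K.Nonempty := ⟨φ 0, 0, by simp, rfl⟩
  rw [PolyConvex, polyHull_eq_polyHullBound hKc hKne]
  constructor
  · intro h
    rw [h]
    exact Set.eq_empty_of_forall_notMem fun x hx =>
      mul_ne_zero (h0 x hx.1) (h1 x hx.1) hx.2
  · intro h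
    have hmul : ∀ y ∈ polyHullBound 2 K, y 0 * y 1 ≠ 0 := fun y hy hy0 =>
      Set.eq_empty_iff_forall_notMem.1 h y ⟨hy, hy0⟩
    refine Set.Subset.antisymm (fun z hz => ?_) fun z hz p C hC => hC z hz
    obtain ⟨c, hc, hzc, hzh⟩ := mem_planarHull_fibre hKc hn hz
      (fun y hy => left_ne_zero_of_mul (hmul y hy)) (fun y hy => right_ne_zero_of_mul (hmul y hy))
    exact mem_of_mem_planarHull_slice hU hDU hφ hinj himm htr
      (fun x hx => hn _ ⟨x, hx, rfl⟩) (fun x hx => h1 _ ⟨x, hx, rfl⟩) hc hzc hzh
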